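/- Let q = p^n ≡ 1 (mod 4) with p ≡ 1 (mod 4), and let F = ⟨φ⟩ be the group of field automorphisms of F_q (generated by the Frobenius x ↦ x^p) acting on P = F_q^× / μ₄. Then for each divisor d of n, the number of fixed points of φ^d on P equals h(d)·(p^d - 1)/4, where h(d) = |Hom(C_{n/d}, μ₄)| equals 4, 2, or 1 according to whether n/d ≡ 0 mod 4, ≡ 2 mod 4, or is odd. -/

import Mathlib

theorem card_ker_aux {G : Type*} [CommGroup G] [IsCyclic G] [Finite G] (d : ℕ) :
    Nat.card (powMonoidHom d : G →* G).ker = (Nat.card G).gcd d := by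
  have h := (powMonoidHom d : G →* G).ker.card_mul_index
  rw [IsCyclic.index_powMonoidHom_ker] at h
  have hpos : 0 < Nat.card G := Nat.card_pos
  have hg : (Nat.card G).gcd d ∣ Nat.card G := Nat.gcd_dvd_left _ _
  have h2 := Nat.mul_div_cancel' hg
  have h3 : 0 < Nat.card G / (Nat.card G).gcd d :=
    Nat.div_pos (Nat.le_of_dvd hpos hg) (Nat.gcd_pos_of_pos_left _ hpos)
  exact Nat.eq_of_mul_eq_mul_right h3 (h.trans h2.symm)

theorem gcd_four_aux (k : ℕ) :
    Nat.gcd k 4 = (if 4 ∣ k then 4 else if 2 ∣ k then 2 else 1) := by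
  rw [← Nat.mod_add_div k 4, Nat.gcd_add_mul_left_left]
  have : k % 4 < 4 := Nat.mod_lt _ (by norm_num)
  have e4 : 4 ∣ k % 4 + 4 * (k / 4) ↔ 4 ∣ k % 4 := by omega
  have e2 : 2 ∣ k % 4 + 4 * (k / 4) ↔ 2 ∣ k % 4 := by omega
  simp only [e4, e2]
  generalize k % 4 = r at *
  interval_cases r <;> decide

theorem geom_aux (a k : ℕ) (ha : a % 4 = 1) :
    ∃ S, a ^ k - 1 = (a - 1) * S ∧ S.gcd 4 = k.gcd 4 := by
  refine ⟨∑ i ∈ Finset.range k, a ^ i, ?_, ?_⟩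
  · have h1 : 1 ≤ a := by omega
    obtain ⟨b, rfl⟩ := Nat.exists_eq_add_of_le' h1
    have := Commute.geom_sum₂_mul (Commute.all ((b:ℤ)+1) 1) k
    have hm := geom_sum_mul ((b:ℤ)+1) k
    have hle : 1 ≤ (b+1)^k := Nat.one_le_pow _ _ (by omega)
    zify [hle]
    push_cast
    simp at hm ⊢
    linarith
  · have hm : (∑ i ∈ Finset.range k, a ^ i) ≡ k [MOD 4] := by
      induction k with
      | zero => rfl
      | succ k ih =>
        rw [Finset.sum_range_succ]
        refine ih.add ?_
        have : a ≡ 1 [MOD 4] := ha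
        simpa using this.pow k
    exact hm.gcd_eq

/-- Let `q = p^n` with `p ≡ 1 (mod 4)` prime, `μ₄ ⊆ F_q^×` the fourth roots of unity and
`P = F_q^×/μ₄`, on which the Frobenius `φ : x ↦ x^p` acts.  For each divisor `d` of `n`
the number of fixed points of `φ^d` (i.e. of `x ↦ x^(p^d)`) on `P` equals
`h(d)·(p^d - 1)/4`, where `h(d) = |Hom(C_{n/d}, μ₄)|` is `4`, `2` or `1` according to
whether `n/d ≡ 0 (mod 4)`, `n/d ≡ 2 (mod 4)`, or `n/d` is odd. -/
theorem stmt_17 (p n : ℕ) [Fact p.Prime] (hp : p % 4 = 1) (hn : 0 < n)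
    (F : Type) [Field F] [Fintype F] (hcard : Fintype.card F = p ^ n)
    (μ4 : Subgroup Fˣ) (hμ4 : ∀ x : Fˣ, x ∈ μ4 ↔ x ^ 4 = 1) :
    ∀ d : ℕ, 0 < d → d ∣ n →
      Nat.card {x : Fˣ ⧸ μ4 |
          QuotientGroup.map μ4 μ4 (powMonoidHom (p ^ d))
            (fun y hy => by
              simp only [Subgroup.mem_comap, powMonoidHom_apply]
              exact (hμ4 _).mpr (by
                rw [← pow_mul, mul_comm, pow_mul, (hμ4 y).mp hy, one_pow])) x = x} =
        (if 4 ∣ n / d then 4 else if 2 ∣ n / d then 2 else 1) * ((p ^ d - 1) / 4) := by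
  intro d hd hdn
  obtain ⟨k, rfl⟩ := hdn
  rw [Nat.mul_div_cancel_left k hd, ← gcd_four_aux]
  have hpd : p ^ d % 4 = 1 := by
    have : p ≡ 1 [MOD 4] := hp
    have h := this.pow d
    rw [one_pow] at h
    exact h
  obtain ⟨S, hS, hSg⟩ := geom_aux (p ^ d) k hpd
  obtain ⟨t, ht⟩ : ∃ t, p ^ d = 4 * t + 1 := ⟨p ^ d / 4, by omega⟩
  have hcF : Nat.card Fˣ = 4 * (t * S) := by
    rw [Nat.card_units, Nat.card_eq_fintype_card, hcard, pow_mul, hS, ht, Nat.add_sub_cancel,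
      mul_assoc]
  have hμ : Nat.card μ4 = 4 := by
    have : μ4 = (powMonoidHom 4 : Fˣ →* Fˣ).ker := by
      ext x
      rw [hμ4, MonoidHom.mem_ker, powMonoidHom_apply]
    rw [this, card_ker_aux, hcF]
    exact Nat.gcd_eq_right (dvd_mul_right 4 _)
  have hP : Nat.card (Fˣ ⧸ μ4) = t * S := by
    have := μ4.card_eq_card_quotient_mul_card_subgroup
    rw [hcF, hμ] at this
    omega
  have : IsCyclic (Fˣ ⧸ μ4) :=
    isCyclic_of_surjective (QuotientGroup.mk' μ4) (QuotientGroup.mk'_surjective μ4)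
  have hker := card_ker_aux (G := Fˣ ⧸ μ4) (4 * t)
  rw [hP, mul_comm 4 t, Nat.gcd_mul_left, hSg] at hker
  have ht4 : (p ^ d - 1) / 4 = t := by omega
  rw [ht4, mul_comm (k.gcd 4) t, ← hker]
  refine Nat.card_congr (Equiv.setCongr ?_)
  ext x
  induction x using QuotientGroup.induction_on with
  | H z =>
    simp only [Set.mem_setOf_eq, SetLike.mem_coe, MonoidHom.mem_ker, powMonoidHom_apply,
      QuotientGroup.map_mk]
    rw [QuotientGroup.mk_pow, ht, pow_succ, mul_eq_right, mul_comm 4 t]
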